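/- For every p > 0 there exist a constant C > 0 and an N₀ such that for all N ≥ N₀ and each m ∈ {0,1,2}, (1/d) Σ_{j : |E_j| ≥ Λ} |E_j|^m ≤ N^{−p}, where Λ = C·√(N·log N) and {E_j}_{j=1}^{d} are the eigenvalues of H_N counted with multiplicity. -/

import Mathlib

open Matrix MeasureTheory Filter

/-- The space of operators on a chain of `N` qudits, each of local dimension `dloc`. -/
abbrev Op (dloc N : ℕ) := Matrix (Fin N → Fin dloc) (Fin N → Fin dloc) ℂ

/-- Cyclic translation of qudit configurations: site `i` of the new configuration carries
the value of site `i - 1` of the old one. -/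
def confShift (dloc N : ℕ) : Equiv.Perm (Fin N → Fin dloc) :=
  Equiv.arrowCongr (finRotate N) (Equiv.refl (Fin dloc))

/-- The translation operator `T` on a chain of `N` qudits, as a permutation matrix. -/
noncomputable def Tmat (dloc N : ℕ) : Op dloc N :=
  fun x y => if x = confShift dloc N y then 1 else 0

/-- Extension of an operator on the first `m` sites to the `N`-site chain, by tensoring
with the identity on the remaining sites (the zero operator if `m > N`). -/
noncomputable def embed (dloc m N : ℕ) (a : Op dloc m) : Op dloc N :=
  if hm : m ≤ N then
    (fun x y => a (fun i => x (Fin.castLE hm i)) (fun i => y (Fin.castLE hm i)) *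
      (if ∀ i : Fin N, m ≤ (i : ℕ) → x i = y i then 1 else 0))
  else 0

/-- The translation-invariant Hamiltonian `H_N = ∑_{l=0}^{N-1} T^l h T^{-l}` built from
a local term `h` on `k` sites. -/
noncomputable def Ham (dloc k N : ℕ) (h : Op dloc k) : Op dloc N :=
  ∑ l : Fin N, Tmat dloc N ^ (l : ℕ) * embed dloc k N h * (Tmat dloc N)ᴴ ^ (l : ℕ)

/-- The operator norm (ℓ²→ℓ² norm) of a matrix. -/
noncomputable def opNorm {n : Type*} [Fintype n] [DecidableEq n] (A : Matrix n n ℂ) : ℝ :=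
  ‖Matrix.toEuclideanCLM (𝕜 := ℂ) (n := n) A‖

/-- An orthonormal basis of simultaneous eigenvectors of the Hamiltonian `H` (with real
eigenvalues `E j`) and of the translation operator `T` (with eigenvalues `τ j`). -/
structure EigData (dloc N : ℕ) (H : Op dloc N) where
  v : (Fin N → Fin dloc) → ((Fin N → Fin dloc) → ℂ)
  E : (Fin N → Fin dloc) → ℝ
  τ : (Fin N → Fin dloc) → ℂ
  orth : ∀ j j', star (v j) ⬝ᵥ v j' = if j = j' then 1 else 0
  eigH : ∀ j, H.mulVec (v j) = (E j : ℂ) • v j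
  eigT : ∀ j, (Tmat dloc N).mulVec (v j) = τ j • v j

/-- The eigenstate expectation value `⟨j|B|j⟩`. -/
noncomputable def eev {dloc N : ℕ} {H : Op dloc N} (D : EigData dloc N H)
    (B : Op dloc N) (j : Fin N → Fin dloc) : ℂ :=
  star (D.v j) ⬝ᵥ B.mulVec (D.v j)

/-- `r_f(N) = ((1/d) ∑_j |⟨j|B|j⟩ - f(E_j/N)|²)^{1/2}`. -/
noncomputable def rf {dloc N : ℕ} {H : Op dloc N} (D : EigData dloc N H)
    (B : Op dloc N) (f : ℝ → ℂ) : ℝ :=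
  Real.sqrt ((1 / (dloc : ℝ) ^ N) * ∑ j, ‖eev D B j - f (D.E j / N)‖ ^ 2)

/-- A function `f : [-1,1] → {z : ℂ, |z| ≤ 1}` (encoded as a total function on `ℝ`)
is smooth with Taylor data `c0 = f(0)`, `c1 = f'(0)`, `c2 = f''(0)` and remainder
constant `M` if `|f(x) - c0 - c1 x - (c2/2) x²| ≤ M |x|³` on `[-1,1]`. -/
def SmoothFn (f : ℝ → ℂ) (c0 c1 c2 : ℂ) (M : ℝ) : Prop :=
  0 ≤ M ∧ (∀ x ∈ Set.Icc (-1 : ℝ) 1, ‖f x‖ ≤ 1) ∧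
    ∀ x ∈ Set.Icc (-1 : ℝ) 1, ‖f x - c0 - c1 * x - c2 / 2 * x ^ 2‖ ≤ M * |x| ^ 3

/-- The generalized Pauli string `X^{a_1}Z^{b_1} ⊗ ⋯ ⊗ X^{a_m}Z^{b_m}` on `m` qudits,
where `X|x⟩ = |x+1 mod dloc⟩` and `Z|x⟩ = ω^x |x⟩` with `ω = exp(2πi/dloc)`. -/
noncomputable def pauli (dloc m : ℕ) (a b : Fin m → Fin dloc) : Op dloc m :=
  fun x y =>
    if ∀ i, (x i : ℕ) = ((y i : ℕ) + (a i : ℕ)) % dloc then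
      ∏ i, Complex.exp (2 * Real.pi * Complex.I * (b i : ℕ) * (y i : ℕ) / dloc)
    else 0

/-- An operator on `k` sites is canonical if every generalized Pauli string with nonzero
coefficient in its expansion acts nontrivially on site 1. -/
def Canonical (dloc k : ℕ) (h : Op dloc k) : Prop :=
  ∀ a b : Fin k → Fin dloc,
    (∀ i : Fin k, (i : ℕ) = 0 → (a i : ℕ) = 0 ∧ (b i : ℕ) = 0) →
      Matrix.trace ((pauli dloc k a b)ᴴ * h) = 0

/-- An operator on `k` sites is exactly `k`-local if some generalized Pauli string with
nonzero coefficient in its expansion acts nontrivially on site `k`. -/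
def ExactlyLocal (dloc k : ℕ) (h : Op dloc k) : Prop :=
  ∃ a b : Fin k → Fin dloc, ∃ i : Fin k, (i : ℕ) = k - 1 ∧ ((a i : ℕ) ≠ 0 ∨ (b i : ℕ) ≠ 0) ∧
    Matrix.trace ((pauli dloc k a b)ᴴ * h) ≠ 0

/-- The submodule (over `ℝ`) of traceless operators on `k'` sites. -/
noncomputable def tracelessOps (dloc k' : ℕ) : Submodule ℝ (Op dloc k') :=
  LinearMap.ker ((Matrix.traceLinearMap (Fin k' → Fin dloc) ℂ ℂ).restrictScalars ℝ)

/-- The translation average `𝔸 = (1/N) ∑_{l=0}^{N-1} T^l A T^{-l}` of an operator. -/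
noncomputable def tavg (dloc N : ℕ) (A : Op dloc N) : Op dloc N :=
  ((N : ℂ))⁻¹ • ∑ l : Fin N, Tmat dloc N ^ (l : ℕ) * A * (Tmat dloc N)ᴴ ^ (l : ℕ)

/-- The operator acting as `a` on the sites `f 0, …, f (k - 1)` and as the identity elsewhere. -/
def siteOp {dloc k N : ℕ} (f : Fin k → Fin N) (a : Op dloc k) : Op dloc N :=
  fun x y => a (x ∘ f) (y ∘ f) * if ∀ i, (∀ q, f q ≠ i) → x i = y i then 1 else 0

section SiteOp

variable {dloc k N : ℕ}

theorem siteOp_mul {f : Fin k → Fin N} (hf : Function.Injective f) (a b : Op dloc k) :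
    siteOp f (a * b) = siteOp f a * siteOp f b := by
  ext x y
  simp only [siteOp, Matrix.mul_apply, Finset.sum_mul]
  refine Fintype.sum_of_injective (fun w => Function.extend f w x) ?_ _ _ ?_ ?_
  · intro w w' hw
    funext q
    simpa [hf.extend_apply] using congrFun hw (f q)
  · intro z hz
    rw [if_neg, mul_zero, zero_mul]
    intro hxz
    refine hz ⟨z ∘ f, ?_⟩
    funext i
    by_cases hi : ∃ q, f q = i
    · obtain ⟨q, rfl⟩ := hi
      simp [hf.extend_apply]
    · simp only [Function.extend_apply' _ _ _ hi]
      exact hxz i (by simpa using hi)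
  · intro w
    have hcomp : Function.extend f w x ∘ f = w := by
      funext q
      simp [hf.extend_apply]
    have hoff : ∀ i, (∀ q, f q ≠ i) → Function.extend f w x i = x i := fun i hi =>
      Function.extend_apply' _ _ _ (by simpa using hi)
    have hiff : (∀ i, (∀ q, f q ≠ i) → Function.extend f w x i = y i) ↔
        ∀ i, (∀ q, f q ≠ i) → x i = y i :=
      forall_congr' fun i => forall_congr' fun hi => by rw [hoff i hi]
    have hself : ∀ i, (∀ q, f q ≠ i) → x i = Function.extend f w x i :=
      fun i hi => (hoff i hi).symm
    simp only [hcomp, if_pos hself, hiff]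
    ring

theorem siteOp_one (f : Fin k → Fin N) : siteOp f (1 : Op dloc k) = 1 := by
  ext x y
  simp only [siteOp, Matrix.one_apply]
  by_cases hxy : x = y
  · simp [hxy]
  · rw [if_neg hxy]
    by_cases hf : x ∘ f = y ∘ f
    · rw [if_neg (c := ∀ i, _), mul_zero]
      intro hoff
      apply hxy
      funext i
      by_cases hi : ∃ q, f q = i
      · obtain ⟨q, rfl⟩ := hi
        exact congrFun hf q
      · exact hoff i (by simpa using hi)
    · rw [if_neg hf, zero_mul]

theorem siteOp_conjTranspose (f : Fin k → Fin N) (a : Op dloc k) :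
    siteOp f aᴴ = (siteOp f a)ᴴ := by
  ext x y
  simp only [siteOp, Matrix.conjTranspose_apply, star_mul', eq_comm (a := x _)]
  split_ifs <;> simp

/-- `siteOp f` as a unital algebra homomorphism. -/
def siteAlgHom (f : Fin k → Fin N) (hf : Function.Injective f) : Op dloc k →ₐ[ℂ] Op dloc N :=
  AlgHom.ofLinearMap
    { toFun := siteOp f
      map_add' := fun a b => by
        ext x y
        simp only [siteOp, Matrix.add_apply, add_mul]
      map_smul' := fun c a => by
        ext x y
        simp only [siteOp, Matrix.smul_apply, smul_eq_mul, RingHom.id_apply, mul_assoc] }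
    (siteOp_one f) (siteOp_mul hf)

theorem siteAlgHom_apply (f : Fin k → Fin N) (hf : Function.Injective f) (a : Op dloc k) :
    siteAlgHom f hf a = siteOp f a := rfl

theorem siteOp_mul_apply_of_disjoint {f g : Fin k → Fin N} (hfg : ∀ q r, f q ≠ g r)
    (a b : Op dloc k) (x y : Fin N → Fin dloc) :
    (siteOp f a * siteOp g b) x y = a (x ∘ f) (y ∘ f) * b (x ∘ g) (y ∘ g) *
      if ∀ i, (∀ q, f q ≠ i) → (∀ q, g q ≠ i) → x i = y i then 1 else 0 := by
  classical
  simp only [siteOp, Matrix.mul_apply]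
  set z₀ : Fin N → Fin dloc := fun i => if ∃ q, f q = i then y i else x i with hz₀
  have hzf : z₀ ∘ f = y ∘ f := by
    funext q
    simp [hz₀]
  have hzg : z₀ ∘ g = x ∘ g := by
    funext q
    simp [hz₀, hfg]
  rw [Finset.sum_eq_single z₀]
  · have hself : ∀ i, (∀ q, f q ≠ i) → x i = z₀ i := fun i hi => by simp [hz₀, hi]
    have hiff : (∀ i, (∀ q, g q ≠ i) → z₀ i = y i) ↔
        ∀ i, (∀ q, f q ≠ i) → (∀ q, g q ≠ i) → x i = y i := by
      refine forall_congr' fun i => ?_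
      by_cases hi : ∃ q, f q = i
      · have : ¬ ∀ q, f q ≠ i := by simpa using hi
        simp [hz₀, hi, this]
      · have : ∀ q, f q ≠ i := by simpa using hi
        simp [hz₀, this]
    rw [hzf, hzg, if_pos hself]
    simp only [hiff]
    ring
  · intro z _ hz
    by_cases h₁ : ∀ i, (∀ q, f q ≠ i) → x i = z i
    · rw [if_neg (c := ∀ i, (∀ q, g q ≠ i) → z i = y i), mul_zero, mul_zero]
      intro h₂
      apply hz
      funext i
      by_cases hi : ∃ q, f q = i
      · obtain ⟨q, rfl⟩ := hi
        simpa [hz₀] using h₂ (f q) fun r => (hfg q r).symm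
      · simpa [hz₀, hi] using (h₁ i (by simpa using hi)).symm
    · rw [if_neg h₁, mul_zero, zero_mul]
  · simp

theorem siteOp_commute {f g : Fin k → Fin N} (hfg : ∀ q r, f q ≠ g r) (a b : Op dloc k) :
    Commute (siteOp f a) (siteOp g b) := by
  ext x y
  rw [siteOp_mul_apply_of_disjoint hfg, siteOp_mul_apply_of_disjoint fun q r => (hfg r q).symm,
    mul_comm (a _ _)]
  congr 2
  exact propext (forall_congr' fun i => imp.swap)

theorem embed_eq_siteOp (hkN : k ≤ N) (a : Op dloc k) :
    embed dloc k N a = siteOp (Fin.castLE hkN) a := by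
  ext x y
  have hiff : (∀ i : Fin N, k ≤ (i : ℕ) → x i = y i) ↔
      ∀ i, (∀ q, Fin.castLE hkN q ≠ i) → x i = y i := by
    refine forall_congr' fun i => imp_congr_left ⟨fun hi q hq => ?_, fun hi => ?_⟩
    · have := congrArg Fin.val hq
      simp only [Fin.val_castLE] at this
      omega
    · by_contra hlt
      exact hi ⟨i, by omega⟩ (Fin.ext rfl)
  have happ : embed dloc k N a x y = a (x ∘ Fin.castLE hkN) (y ∘ Fin.castLE hkN) *
      if ∀ i : Fin N, k ≤ (i : ℕ) → x i = y i then 1 else 0 := by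
    have hdef : embed dloc k N a = fun x y => a (x ∘ Fin.castLE hkN) (y ∘ Fin.castLE hkN) *
        if ∀ i : Fin N, k ≤ (i : ℕ) → x i = y i then 1 else 0 := dif_pos hkN
    exact congrFun (congrFun hdef x) y
  rw [happ]
  simp only [siteOp, hiff]

theorem Tmat_conj_apply (A : Op dloc N) (x y : Fin N → Fin dloc) :
    (Tmat dloc N * A * (Tmat dloc N)ᴴ) x y = A (x ∘ finRotate N) (y ∘ finRotate N) := by
  have hshift : ∀ u v : Fin N → Fin dloc, u = confShift dloc N v ↔ v = u ∘ finRotate N := by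
    intro u v
    rw [← Equiv.symm_apply_eq, eq_comm]
    rfl
  simp [Matrix.mul_apply, Tmat, hshift]

theorem Tmat_conj_siteOp (f : Fin k → Fin N) (a : Op dloc k) :
    Tmat dloc N * siteOp f a * (Tmat dloc N)ᴴ = siteOp (finRotate N ∘ f) a := by
  ext x y
  rw [Tmat_conj_apply]
  simp only [siteOp]
  congr 2
  refine propext ((finRotate N).forall_congr fun i => ?_)
  simp

theorem Tmat_pow_conj_siteOp (f : Fin k → Fin N) (a : Op dloc k) (l : ℕ) :
    Tmat dloc N ^ l * siteOp f a * (Tmat dloc N)ᴴ ^ l = siteOp ((finRotate N)^[l] ∘ f) a := by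
  induction l with
  | zero => simp
  | succ l ih =>
    rw [Function.iterate_succ', Function.comp_assoc, ← Tmat_conj_siteOp, ← ih, pow_succ', pow_succ]
    simp only [mul_assoc]

theorem val_finRotate_iterate (l : ℕ) (i : Fin N) :
    (((finRotate N)^[l] i : Fin N) : ℕ) = (i + l) % N := by
  have : NeZero N := ⟨by have := i.2; omega⟩
  induction l with
  | zero => simp [Nat.mod_eq_of_lt i.2]
  | succ l ih =>
    rw [Function.iterate_succ_apply', finRotate_apply, Fin.val_add, ih, Fin.val_one']
    simp [← add_assoc]

/-- The window of `k` consecutive sites starting at site `l`. -/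
def window (hkN : k ≤ N) (l : ℕ) : Fin k → Fin N := (finRotate N)^[l] ∘ Fin.castLE hkN

theorem window_injective (hkN : k ≤ N) (l : ℕ) : Function.Injective (window hkN l) :=
  ((finRotate N).injective.iterate l).comp (Fin.castLE_injective hkN)

theorem Ham_eq_sum_siteOp (hkN : k ≤ N) (h : Op dloc k) :
    Ham dloc k N h = ∑ l : Fin N, siteOp (window hkN l) h := by
  simp only [Ham, embed_eq_siteOp hkN, Tmat_pow_conj_siteOp, window]

/-- A coloring of the positions in the chain such that windows starting at distinct positions of
the same color are disjoint. -/
def windowColor (k N l : ℕ) : ℕ := if l + k ≤ N then l % k else k + (N - l)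

theorem windowColor_lt (hk : 1 ≤ k) {l : ℕ} : windowColor k N l < 2 * k := by
  have := Nat.mod_lt l hk
  unfold windowColor
  split_ifs <;> omega

theorem window_disjoint (hkN : k ≤ N) {l l' : Fin N} (hne : l ≠ l')
    (hcol : windowColor k N l = windowColor k N l') (q r : Fin k) :
    window hkN l q ≠ window hkN l' r := by
  have hk : 0 < k := q.pos
  have hne' : (l : ℕ) ≠ l' := fun e => hne (Fin.ext e)
  have h₁ := Nat.mod_lt (l : ℕ) hk
  have h₂ := Nat.mod_lt (l' : ℕ) hk
  unfold windowColor at hcol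
  split_ifs at hcol with hl hl' hl'
  · intro heq
    have hval := congrArg Fin.val heq
    simp only [window, Function.comp_apply, val_finRotate_iterate, Fin.val_castLE] at hval
    rw [Nat.mod_eq_of_lt (by omega), Nat.mod_eq_of_lt (by omega)] at hval
    have hq := q.2
    have hr := r.2
    have e₁ := Nat.div_add_mod (l : ℕ) k
    have e₂ := Nat.div_add_mod (l' : ℕ) k
    rcases lt_trichotomy ((l : ℕ) / k) ((l' : ℕ) / k) with hlt | heq' | hlt
    · have := Nat.mul_le_mul_left k hlt
      rw [Nat.mul_succ] at this
      omega
    · rw [heq'] at e₁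
      omega
    · have := Nat.mul_le_mul_left k hlt
      rw [Nat.mul_succ] at this
      omega
  all_goals omega

end SiteOp

section MatrixExp

open NormedSpace
open scoped ComplexOrder MatrixOrder

variable {n : Type*} [Fintype n] [DecidableEq n]

theorem posSemidef_exp_add_affine {A : Matrix n n ℂ} (hA : A.IsHermitian) (s α β γ : ℝ)
    (hpos : ∀ i, 0 ≤ α * Real.exp (s * hA.eigenvalues i) + β + γ * hA.eigenvalues i) :
    ((α : ℂ) • exp ((s : ℂ) • A) + (β : ℂ) • (1 : Matrix n n ℂ) + (γ : ℂ) • A).PosSemidef := by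
  set U : Matrix n n ℂ := (hA.eigenvectorUnitary : Matrix n n ℂ)
  set D : Matrix n n ℂ := diagonal (fun i => (hA.eigenvalues i : ℂ)) with hD
  have hUU : U * Uᴴ = 1 := Unitary.mul_star_self_of_mem hA.eigenvectorUnitary.2
  have hUinv : U⁻¹ = Uᴴ := Matrix.inv_eq_right_inv hUU
  have hAD : A = U * D * Uᴴ := by
    conv_lhs => rw [hA.spectral_theorem, Unitary.conjStarAlgAut_apply]
    rfl
  have hexp : exp ((s : ℂ) • A) =
      U * diagonal (fun i => Complex.exp (s * hA.eigenvalues i)) * Uᴴ := by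
    have hsA : (s : ℂ) • A = U * ((s : ℂ) • D) * U⁻¹ := by
      rw [hUinv, Matrix.mul_smul, Matrix.smul_mul, ← hAD]
    rw [hsA, Matrix.exp_conj _ _ (IsUnit.of_mul_eq_one _ hUU), hUinv, hD,
      ← Matrix.diagonal_smul, Matrix.exp_diagonal]
    congr 2
    refine congrArg diagonal (funext fun i => ?_)
    rw [Pi.coe_exp, Complex.exp_eq_exp_ℂ]
    rfl
  have hsum : (α : ℂ) • exp ((s : ℂ) • A) + (β : ℂ) • (1 : Matrix n n ℂ) + (γ : ℂ) • A =
      U * diagonal (fun i => ((α * Real.exp (s * hA.eigenvalues i) + β +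
        γ * hA.eigenvalues i : ℝ) : ℂ)) * Uᴴ := by
    have hdiag : diagonal (fun i => ((α * Real.exp (s * hA.eigenvalues i) + β +
        γ * hA.eigenvalues i : ℝ) : ℂ)) =
        (α : ℂ) • diagonal (fun i => Complex.exp (s * hA.eigenvalues i)) +
          (β : ℂ) • (1 : Matrix n n ℂ) + (γ : ℂ) • D := by
      rw [hD, ← Matrix.diagonal_smul, ← Matrix.diagonal_smul, ← Matrix.diagonal_one,
        ← Matrix.diagonal_smul, Matrix.diagonal_add, Matrix.diagonal_add]
      refine congrArg diagonal (funext fun i => ?_)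
      simp
    rw [hexp, hdiag]
    simp only [Matrix.mul_add, Matrix.add_mul, Matrix.mul_smul, Matrix.smul_mul, mul_one, hUU,
      ← hAD]
  rw [hsum]
  refine (PosSemidef.diagonal fun i => ?_).mul_mul_conjTranspose_same U
  exact Complex.zero_le_real.2 (hpos i)

open scoped Matrix.Norms.Operator in
theorem algHom_matrix_exp {m : Type*} [Fintype m] [DecidableEq m]
    (φ : Matrix m m ℂ →ₐ[ℂ] Matrix n n ℂ) (A : Matrix m m ℂ) : φ (exp A) = exp (φ A) :=
  map_exp φ φ.toLinearMap.continuous_of_finiteDimensional A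

theorem Matrix.IsHermitian.real_smul {m : Type*} {A : Matrix m m ℂ} (hA : A.IsHermitian) (s : ℝ) :
    ((s : ℂ) • A).IsHermitian := by
  rw [Matrix.IsHermitian, Matrix.conjTranspose_smul, hA.eq]
  simp

theorem posSemidef_exp {A : Matrix n n ℂ} (hA : A.IsHermitian) : (exp A).PosSemidef := by
  have := posSemidef_exp_add_affine hA 1 1 0 0 fun i => by simpa using (Real.exp_pos _).le
  simpa using this

/-- Peierls' inequality for a unit vector. -/
theorem exp_re_expectation_le {A : Matrix n n ℂ} (hA : A.IsHermitian) {v : n → ℂ}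
    (hv : star v ⬝ᵥ v = 1) :
    Real.exp (star v ⬝ᵥ A *ᵥ v).re ≤ (star v ⬝ᵥ exp A *ᵥ v).re := by
  set c := (star v ⬝ᵥ A *ᵥ v).re with hc
  have hpsd := posSemidef_exp_add_affine hA 1 1 (Real.exp c * (c - 1)) (-Real.exp c) fun i => by
    have h₁ := Real.add_one_le_exp (hA.eigenvalues i - c)
    have h₂ : Real.exp (hA.eigenvalues i) =
        Real.exp c * Real.exp (hA.eigenvalues i - c) := by
      rw [← Real.exp_add]
      ring_nf
    rw [one_mul, one_mul, h₂]
    nlinarith [Real.exp_pos c]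
  have hnn := (Complex.le_def.1 (hpsd.dotProduct_mulVec_nonneg v)).1
  simp only [Matrix.add_mulVec, Matrix.smul_mulVec, dotProduct_add, dotProduct_smul,
    Matrix.one_mulVec, hv, Complex.ofReal_one, one_smul, smul_eq_mul, Complex.add_re,
    Complex.re_ofReal_mul, ← hc, Complex.one_re, Complex.zero_re] at hnn
  linarith

theorem sum_expectation_eq_trace {v : n → n → ℂ}
    (hv : ∀ j j', star (v j) ⬝ᵥ v j' = if j = j' then 1 else 0) (A : Matrix n n ℂ) :
    ∑ j, star (v j) ⬝ᵥ A *ᵥ v j = A.trace := by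
  set V : Matrix n n ℂ := Matrix.of fun i j => v j i
  have hVV : Vᴴ * V = 1 := by
    ext i j
    rw [Matrix.one_apply, ← hv i j]
    rfl
  have hdiag : ∀ j, star (v j) ⬝ᵥ A *ᵥ v j = (Vᴴ * (A * V)) j j := fun j => rfl
  calc ∑ j, star (v j) ⬝ᵥ A *ᵥ v j = (Vᴴ * (A * V)).trace := by
        simp only [hdiag, Matrix.trace, Matrix.diag]
    _ = A.trace := by
        rw [Matrix.trace_mul_comm, mul_assoc, mul_eq_one_comm.1 hVV, mul_one]

/-- A tracial functional on a matrix algebra vanishes on traceless matrices. -/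
theorem map_eq_zero_of_trace_eq_zero (φ : Matrix n n ℂ →ₗ[ℂ] ℂ)
    (hφ : ∀ a b, φ (a * b) = φ (b * a)) {a : Matrix n n ℂ} (ha : a.trace = 0) : φ a = 0 := by
  rcases isEmpty_or_nonempty n with hn | ⟨⟨i₀⟩⟩
  · rw [Subsingleton.elim a 0, map_zero]
  have hdiag : ∀ i, φ (single i i 1) = φ (single i₀ i₀ 1) := fun i => by
    simpa using hφ (single i i₀ 1) (single i₀ i 1)
  have hoff : ∀ i j, i ≠ j → φ (single i j 1) = 0 := fun i j hij => by
    simpa [hij, hij.symm] using hφ (single i i 1) (single i j 1)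
  have hentry : ∀ i j, φ (single i j (a i j)) =
      if i = j then a i i * φ (single i₀ i₀ 1) else 0 := fun i j => by
    have : single i j (a i j) = a i j • single i j (1 : ℂ) := by simp [Matrix.smul_single]
    rw [this, map_smul, smul_eq_mul]
    split_ifs with hij
    · subst hij
      rw [hdiag]
    · rw [hoff i j hij, mul_zero]
  rw [Matrix.matrix_eq_sum_single a]
  simp only [map_sum, hentry, Finset.sum_ite_eq, Finset.mem_univ, if_true]
  rw [← Finset.sum_mul]
  change a.trace * _ = 0
  rw [ha, zero_mul]

theorem abs_eigenvalues_le_opNorm {A : Matrix n n ℂ} (hA : A.IsHermitian) (i : n) :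
    |hA.eigenvalues i| ≤ opNorm A := by
  have h₁ := (Matrix.toEuclideanCLM (𝕜 := ℂ) (n := n) A).le_opNorm (hA.eigenvectorBasis i)
  have h₂ : Matrix.toEuclideanCLM (𝕜 := ℂ) (n := n) A (hA.eigenvectorBasis i) =
      (hA.eigenvalues i : ℂ) • hA.eigenvectorBasis i := by
    ext q
    simpa using congrFun (hA.mulVec_eigenvectorBasis i) q
  rw [h₂, norm_smul, (hA.eigenvectorBasis.orthonormal).1 i] at h₁
  simpa [opNorm] using h₁

theorem exp_mul_le_cosh_add_mul_sinh (s : ℝ) {x : ℝ} (hx : |x| ≤ 1) :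
    Real.exp (s * x) ≤ Real.cosh s + x * Real.sinh s := by
  obtain ⟨h₁, h₂⟩ := abs_le.1 hx
  have hconv := convexOn_exp.2 (Set.mem_univ s) (Set.mem_univ (-s))
    (show (0 : ℝ) ≤ (1 + x) / 2 by linarith) (show (0 : ℝ) ≤ (1 - x) / 2 by linarith) (by ring)
  simp only [smul_eq_mul] at hconv
  have harg : (1 + x) / 2 * s + (1 - x) / 2 * -s = s * x := by ring
  rw [harg] at hconv
  rw [Real.cosh_eq, Real.sinh_eq]
  linarith

theorem trace_exp_sum_siteOp_le {dloc k N : ℕ} {ι : Type*} [DecidableEq ι]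
    {f : ι → Fin k → Fin N} (hf : ∀ l, Function.Injective (f l)) (S : Finset ι)
    (hS : ∀ l ∈ S, ∀ l' ∈ S, l ≠ l' → ∀ q r, f l q ≠ f l' r)
    {h : Op dloc k} (hherm : h.IsHermitian) (htr : h.trace = 0) (hnorm : opNorm h ≤ 1) (s : ℝ) :
    (exp ((s : ℂ) • ∑ l ∈ S, siteOp (f l) h)).trace.re ≤
      (dloc : ℝ) ^ N * Real.cosh s ^ S.card := by
  induction S using Finset.induction_on with
  | empty =>
    have : ((dloc : ℂ) ^ N).re = (dloc : ℝ) ^ N := by norm_cast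
    simp [Matrix.trace_one, this]
  | insert l S hl ih =>
    specialize ih fun a ha b hb =>
      hS a (Finset.mem_insert_of_mem ha) b (Finset.mem_insert_of_mem hb)
    set B : Op dloc N := exp ((s : ℂ) • ∑ l ∈ S, siteOp (f l) h) with hB
    have hsumherm : (∑ l ∈ S, siteOp (f l) h).IsHermitian := by
      rw [Matrix.IsHermitian, Matrix.conjTranspose_sum]
      exact Finset.sum_congr rfl fun l _ => by rw [← siteOp_conjTranspose, hherm.eq]
    have hBpsd : B.PosSemidef := posSemidef_exp (hsumherm.real_smul s)
    have hcommsum : ∀ a, Commute ((s : ℂ) • ∑ l ∈ S, siteOp (f l) h) (siteOp (f l) a) :=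
      fun a => Commute.smul_left (Commute.sum_left _ _ _ fun l' hl' => siteOp_commute
        (hS l' (Finset.mem_insert_of_mem hl') l (Finset.mem_insert_self _ _)
          (by rintro rfl; exact hl hl')) h a) _
    have hcomm : ∀ a, Commute B (siteOp (f l) a) := fun a =>
      (hcommsum a).exp_left
    have hexp : exp ((s : ℂ) • siteOp (f l) h) = siteOp (f l) (exp ((s : ℂ) • h)) := by
      rw [← siteAlgHom_apply _ (hf l), ← siteAlgHom_apply _ (hf l), algHom_matrix_exp, map_smul]
    have hzero : (B * siteOp (f l) h).trace = 0 := by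
      refine map_eq_zero_of_trace_eq_zero ((Matrix.traceLinearMap _ ℂ ℂ).comp
        ((LinearMap.mulLeft ℂ B).comp (siteAlgHom (f l) (hf l)).toLinearMap)) (fun a b => ?_) htr
      change (B * siteOp (f l) (a * b)).trace = (B * siteOp (f l) (b * a)).trace
      rw [siteOp_mul (hf l), siteOp_mul (hf l), ← mul_assoc, (hcomm a).eq, mul_assoc,
        Matrix.trace_mul_comm, mul_assoc]
    have hpsd := posSemidef_exp_add_affine hherm s (-1) (Real.cosh s) (Real.sinh s) fun i => by
      have := exp_mul_le_cosh_add_mul_sinh s ((abs_eigenvalues_le_opNorm hherm i).trans hnorm)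
      linarith
    obtain ⟨Q, hQ⟩ := CStarAlgebra.nonneg_iff_eq_star_mul_self.1 hpsd.nonneg
    have hmap : siteOp (f l) (Qᴴ * Q) = -siteOp (f l) (exp ((s : ℂ) • h)) +
        (Real.cosh s : ℂ) • 1 + (Real.sinh s : ℂ) • siteOp (f l) h := by
      rw [← Matrix.star_eq_conjTranspose, ← hQ, ← siteAlgHom_apply _ (hf l)]
      simp only [map_add, map_smul, map_one, siteAlgHom_apply]
      simp
    have hnn : 0 ≤ (B * siteOp (f l) (Qᴴ * Q)).trace := by
      rw [siteOp_mul (hf l), siteOp_conjTranspose, ← mul_assoc, Matrix.trace_mul_comm, ← mul_assoc]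
      exact (hBpsd.mul_mul_conjTranspose_same _).trace_nonneg
    rw [hmap] at hnn
    have hre := (Complex.le_def.1 hnn).1
    simp only [Matrix.mul_add, Matrix.mul_neg, Matrix.mul_smul, mul_one, Matrix.trace_add,
      Matrix.trace_neg, Matrix.trace_smul, hzero, smul_eq_mul,
      Complex.add_re, Complex.neg_re, Complex.re_ofReal_mul, Complex.zero_re] at hre
    rw [Finset.sum_insert hl, add_comm, smul_add, Matrix.exp_add_of_commute _ _
      ((hcommsum h).smul_right _), hexp, Finset.card_insert_of_notMem hl, ← hB]
    calc (B * siteOp (f l) (exp ((s : ℂ) • h))).trace.re ≤ Real.cosh s * B.trace.re := by linarith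
      _ ≤ Real.cosh s * ((dloc : ℝ) ^ N * Real.cosh s ^ S.card) := by
        gcongr
      _ = _ := by ring

end MatrixExp

section Tail

variable {dloc k N : ℕ}

/-- The energies of the chain have a sub-Gaussian moment generating function. -/
theorem sum_exp_energy_le (hk : 1 ≤ k) (hkN : k ≤ N) {h : Op dloc k} (hherm : h.IsHermitian)
    (htr : h.trace = 0) (hnorm : opNorm h ≤ 1) (D : EigData dloc N (Ham dloc k N h)) (t : ℝ) :
    ∑ j, Real.exp (t * D.E j) ≤
      (dloc : ℝ) ^ N * Real.exp ((2 * k : ℝ) ^ 2 * t ^ 2 / 2 * N) := by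
  set S : ℕ → Finset (Fin N) := fun c =>
    Finset.univ.filter fun l : Fin N => windowColor k N l = c
  set A : ℕ → Op dloc N := fun c => ∑ l ∈ S c, siteOp (window hkN l) h
  have hAherm : ∀ c, (A c).IsHermitian := fun c => by
    rw [Matrix.IsHermitian, Matrix.conjTranspose_sum]
    exact Finset.sum_congr rfl fun l _ => by rw [← siteOp_conjTranspose, hherm.eq]
  have hHam : Ham dloc k N h = ∑ c ∈ Finset.range (2 * k), A c := by
    rw [Ham_eq_sum_siteOp hkN]
    exact (Finset.sum_fiberwise_of_maps_to
      (fun l _ => Finset.mem_range.2 (windowColor_lt hk)) _).symm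
  have hk0 : (0 : ℝ) < 2 * k := by
    have : (1 : ℝ) ≤ k := by exact_mod_cast hk
    linarith
  have hE : ∀ j, D.E j =
      ∑ c ∈ Finset.range (2 * k), (star (D.v j) ⬝ᵥ A c *ᵥ D.v j).re := fun j => by
    have h₁ : star (D.v j) ⬝ᵥ Ham dloc k N h *ᵥ D.v j = D.E j := by
      rw [D.eigH, dotProduct_smul, D.orth, if_pos rfl, smul_eq_mul, mul_one]
    have h₂ : Ham dloc k N h *ᵥ D.v j = ∑ c ∈ Finset.range (2 * k), A c *ᵥ D.v j :=
      (congrArg (· *ᵥ D.v j) hHam).trans (Matrix.sum_mulVec _ _ _)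
    rw [← Complex.ofReal_re (D.E j), ← h₁, h₂, dotProduct_sum, Complex.re_sum]
  have hjensen : ∀ j, Real.exp (t * D.E j) ≤ ∑ c ∈ Finset.range (2 * k), (2 * k : ℝ)⁻¹ *
      (star (D.v j) ⬝ᵥ NormedSpace.exp (((2 * k * t : ℝ) : ℂ) • A c) *ᵥ D.v j).re := fun j => by
    have hconv := convexOn_exp.map_sum_le (t := Finset.range (2 * k))
      (w := fun _ => (2 * k : ℝ)⁻¹)
      (p := fun c => 2 * k * t * (star (D.v j) ⬝ᵥ A c *ᵥ D.v j).re)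
      (fun _ _ => by positivity) (by simp; field_simp) (fun _ _ => Set.mem_univ _)
    simp only [smul_eq_mul] at hconv
    have harg : ∑ c ∈ Finset.range (2 * k), (2 * k : ℝ)⁻¹ *
        (2 * k * t * (star (D.v j) ⬝ᵥ A c *ᵥ D.v j).re) = t * D.E j := by
      rw [hE, Finset.mul_sum]
      refine Finset.sum_congr rfl fun c _ => ?_
      field_simp
    rw [harg] at hconv
    refine hconv.trans (Finset.sum_le_sum fun c _ => ?_)
    gcongr
    have hpeierls := exp_re_expectation_le ((hAherm c).real_smul (2 * k * t))
      (v := D.v j) (by rw [D.orth, if_pos rfl])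
    rwa [Matrix.smul_mulVec, dotProduct_smul, smul_eq_mul, Complex.re_ofReal_mul] at hpeierls
  have hcolor : ∀ c, (NormedSpace.exp (((2 * k * t : ℝ) : ℂ) • A c)).trace.re ≤
      (dloc : ℝ) ^ N * Real.exp ((2 * k : ℝ) ^ 2 * t ^ 2 / 2 * N) := fun c => by
    refine (trace_exp_sum_siteOp_le (f := fun l : Fin N => window hkN l)
      (fun l => window_injective hkN l) (S c) ?_ hherm htr hnorm _).trans ?_
    · intro l hl l' hl' hne
      refine window_disjoint hkN hne ?_
      rw [(Finset.mem_filter.1 hl).2, (Finset.mem_filter.1 hl').2]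
    · gcongr
      calc Real.cosh (2 * k * t) ^ (S c).card ≤ Real.cosh (2 * k * t) ^ N := by
            refine pow_le_pow_right₀ (Real.one_le_cosh _) ?_
            simpa using Finset.card_le_univ (S c)
        _ ≤ Real.exp ((2 * k * t) ^ 2 / 2) ^ N := by
            gcongr
            exact Real.cosh_le_exp_half_sq _
        _ = _ := by
            rw [← Real.exp_nat_mul]
            ring_nf
  calc ∑ j, Real.exp (t * D.E j)
      ≤ ∑ j, ∑ c ∈ Finset.range (2 * k), (2 * k : ℝ)⁻¹ *
        (star (D.v j) ⬝ᵥ NormedSpace.exp (((2 * k * t : ℝ) : ℂ) • A c) *ᵥ D.v j).re :=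
        Finset.sum_le_sum fun j _ => hjensen j
    _ = ∑ c ∈ Finset.range (2 * k), (2 * k : ℝ)⁻¹ *
        (NormedSpace.exp (((2 * k * t : ℝ) : ℂ) • A c)).trace.re := by
        rw [Finset.sum_comm]
        refine Finset.sum_congr rfl fun c _ => ?_
        rw [← Finset.mul_sum, ← Complex.re_sum, sum_expectation_eq_trace D.orth]
    _ ≤ ∑ c ∈ Finset.range (2 * k), (2 * k : ℝ)⁻¹ *
        ((dloc : ℝ) ^ N * Real.exp ((2 * k : ℝ) ^ 2 * t ^ 2 / 2 * N)) := by
        gcongr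
        exact hcolor _
    _ = _ := by
        rw [Finset.sum_const, Finset.card_range, nsmul_eq_mul]
        push_cast
        field_simp

theorem pow_le_two_div_mul_exp {t x : ℝ} (ht : 0 < t) (hx : 0 ≤ x) {m : ℕ} (hm : m ≤ 2) :
    x ^ m ≤ 2 / t ^ m * Real.exp (t * x) := by
  have hfact : (m.factorial : ℝ) ≤ 2 := by
    exact_mod_cast (Nat.factorial_le hm : m.factorial ≤ 2)
  have h₁ := Real.pow_div_factorial_le_exp (t * x) (by positivity) m
  rw [div_le_iff₀ (by positivity), mul_pow] at h₁
  rw [div_mul_eq_mul_div, le_div_iff₀ (by positivity)]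
  nlinarith [Real.exp_pos (t * x)]

/-- A Chernoff bound for truncated moments under a two-sided exponential moment bound. -/
theorem sum_truncated_pow_le {ι : Type*} [Fintype ι] (E : ι → ℝ) {t B L : ℝ} (ht : 0 < t)
    (hpos : ∑ j, Real.exp (2 * t * E j) ≤ B) (hneg : ∑ j, Real.exp (-(2 * t) * E j) ≤ B)
    {m : ℕ} (hm : m ≤ 2) :
    (∑ j, if L ≤ |E j| then |E j| ^ m else 0) ≤ 4 / t ^ m * Real.exp (-(t * L)) * B := by
  have hterm : ∀ j, (if L ≤ |E j| then |E j| ^ m else 0) ≤ 2 / t ^ m * Real.exp (-(t * L)) *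
      (Real.exp (2 * t * E j) + Real.exp (-(2 * t) * E j)) := fun j => by
    split_ifs with hj
    · have h₁ := pow_le_two_div_mul_exp ht (abs_nonneg (E j)) hm
      have h₂ : Real.exp (t * |E j|) ≤ Real.exp (-(t * L)) * Real.exp (2 * t * |E j|) := by
        rw [← Real.exp_add, Real.exp_le_exp]
        nlinarith
      have h₃ : Real.exp (2 * t * |E j|) ≤
          Real.exp (2 * t * E j) + Real.exp (-(2 * t) * E j) := by
        have p₁ := Real.exp_pos (2 * t * E j)
        have p₂ := Real.exp_pos (-(2 * t) * E j)
        rcases abs_choice (E j) with he | he <;> rw [he]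
        · linarith
        · rw [mul_neg, ← neg_mul]
          linarith
      calc |E j| ^ m ≤ 2 / t ^ m * Real.exp (t * |E j|) := h₁
        _ ≤ 2 / t ^ m * (Real.exp (-(t * L)) *
            (Real.exp (2 * t * E j) + Real.exp (-(2 * t) * E j))) := by
            gcongr
            exact h₂.trans (by gcongr)
        _ = _ := by ring
    · positivity
  calc _ ≤ ∑ j, 2 / t ^ m * Real.exp (-(t * L)) *
        (Real.exp (2 * t * E j) + Real.exp (-(2 * t) * E j)) :=
        Finset.sum_le_sum fun j _ => hterm j
    _ = 2 / t ^ m * Real.exp (-(t * L)) *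
        (∑ j, Real.exp (2 * t * E j) + ∑ j, Real.exp (-(2 * t) * E j)) := by
        rw [← Finset.mul_sum, Finset.sum_add_distrib]
    _ ≤ 2 / t ^ m * Real.exp (-(t * L)) * (B + B) := by gcongr
    _ = _ := by ring

end Tail

/-- For every `p > 0` there are `C > 0` and `N₀` such that for all `N ≥ N₀` and
each `m ∈ {0,1,2}`, `(1/d) ∑_{j : |E_j| ≥ Λ} |E_j|^m ≤ N^{-p}` where `Λ = C √(N log N)`. -/
theorem truncated_moments_small (dloc k : ℕ) (hdloc : 2 ≤ dloc) (hk : 1 ≤ k)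
    (h : Op dloc k) (hherm : h.IsHermitian) (htr : h.trace = 0) (hnorm : opNorm h = 1)
    (D : ∀ N, EigData dloc N (Ham dloc k N h)) :
    ∀ p : ℝ, 0 < p → ∃ C : ℝ, 0 < C ∧ ∃ N₀ : ℕ, ∀ N : ℕ, N₀ ≤ N → ∀ m : ℕ, m ≤ 2 →
      (1 / (dloc : ℝ) ^ N) *
          (∑ j, if C * Real.sqrt ((N : ℝ) * Real.log N) ≤ |(D N).E j|
            then |(D N).E j| ^ m else 0) ≤
        (N : ℝ) ^ (-p) := by
  intro p hp
  set K : ℝ := (2 * k : ℝ) ^ 2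
  refine ⟨p + 2 + 2 * K, by positivity, max k 4, fun N hN m hm => ?_⟩
  have hkN : k ≤ N := (le_max_left _ _).trans hN
  have hN4 : (4 : ℝ) ≤ N := by exact_mod_cast (le_max_right _ _).trans hN
  have hN0 : (0 : ℝ) < N := by linarith
  have hlog : 1 ≤ Real.log N := by
    rw [Real.le_log_iff_exp_le hN0]
    linarith [Real.exp_one_lt_d9]
  set t : ℝ := Real.sqrt (Real.log N / N) with ht
  have ht0 : 0 < t := Real.sqrt_pos.2 (by positivity)
  have ht2 : t ^ 2 * N = Real.log N := by
    rw [ht, Real.sq_sqrt (by positivity)]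
    field_simp
  have htL : t * Real.sqrt (N * Real.log N) = Real.log N := by
    rw [ht, ← Real.sqrt_mul (by positivity)]
    have : Real.log N / N * (N * Real.log N) = Real.log N ^ 2 := by field_simp
    rw [this, Real.sqrt_sq (by linarith)]
  have htm : 1 / t ^ m ≤ N := by
    rw [div_le_iff₀ (by positivity)]
    interval_cases m
    · linarith
    · have h₁ : 1 ≤ N * t ^ 2 := by linarith
      have h₂ : 1 ≤ (N * t) ^ 2 := by nlinarith
      simpa using (one_le_sq_iff₀ (by positivity)).1 h₂
    · linarith
  have hpos := sum_exp_energy_le hk hkN hherm htr hnorm.le (D N) (2 * t)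
  have hneg := sum_exp_energy_le hk hkN hherm htr hnorm.le (D N) (-(2 * t))
  rw [neg_sq] at hneg
  have htail := sum_truncated_pow_le (D N).E ht0 hpos hneg hm
    (L := (p + 2 + 2 * K) * Real.sqrt (N * Real.log N))
  have hd : (0 : ℝ) < (dloc : ℝ) ^ N := by positivity
  have hexp₁ : Real.exp (-(t * ((p + 2 + 2 * K) * Real.sqrt (N * Real.log N)))) *
      Real.exp (K * (2 * t) ^ 2 / 2 * N) = (N : ℝ) ^ (-p - 2) := by
    have e₁ : t * ((p + 2 + 2 * K) * Real.sqrt (N * Real.log N)) =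
        (p + 2 + 2 * K) * Real.log N := by
      rw [mul_left_comm, htL]
    have e₂ : K * (2 * t) ^ 2 / 2 * N = 2 * K * Real.log N := by
      rw [← ht2]
      ring
    rw [e₁, e₂, ← Real.exp_add, Real.rpow_def_of_pos hN0]
    ring_nf
  rw [one_div, inv_mul_le_iff₀ hd]
  calc _ ≤ _ := htail
    _ = (dloc : ℝ) ^ N * (4 * (1 / t ^ m) * (N : ℝ) ^ (-p - 2)) := by
      rw [← hexp₁]
      ring
    _ ≤ (dloc : ℝ) ^ N * (N * N * (N : ℝ) ^ (-p - 2)) := by gcongr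
    _ = (dloc : ℝ) ^ N * (N : ℝ) ^ (-p) := by
      have hsplit : (N : ℝ) ^ (-p) = (N : ℝ) ^ (-p - 2) * (N : ℝ) ^ (2 : ℝ) := by
        rw [← Real.rpow_add hN0]
        ring_nf
      rw [hsplit, Real.rpow_two]
      ring
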